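/- arXiv:0903.2870 — 3 statements merged into one kernel-verified Lean document; each statement's English description precedes it below -/
import Mathlib

section
/- Let p be a prime number and let C be a finite nonempty subset of ℚ_p partitioned into pairwise disjoint nonempty subsets C_1, …, C_m whose union is C. Then Σ_{i=1}^m (#C_i − 1)·μ(C_i) ≤ (#C − 1)·μ(C). Moreover, if m ≥ 2 then the inequality is strict. -/
open Finset

/-- The diameter `μ(C) = max {‖x - y‖ : x, y ∈ C}` of a finite set of `p`-adic numbers
(by convention `0` for the empty set, in particular `μ(C) = 0` for singletons). -/
noncomputable def mu {p : ℕ} [Fact p.Prime] (C : Finset ℚ_[p]) : ℝ :=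
  if h : C.Nonempty then (C ×ˢ C).sup' (h.product h) (fun xy => ‖xy.1 - xy.2‖) else 0

theorem norm_sub_le_mu {p : ℕ} [Fact p.Prime] {C : Finset ℚ_[p]} {x y : ℚ_[p]}
    (hx : x ∈ C) (hy : y ∈ C) : ‖x - y‖ ≤ mu C := by
  have hC : C.Nonempty := ⟨x, hx⟩
  rw [mu, dif_pos hC]
  exact le_sup' (fun xy : ℚ_[p] × ℚ_[p] => ‖xy.1 - xy.2‖) (mk_mem_product hx hy)

theorem mu_nonneg {p : ℕ} [Fact p.Prime] (C : Finset ℚ_[p]) : 0 ≤ mu C := by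
  rcases C.eq_empty_or_nonempty with rfl | ⟨x, hx⟩
  · simp [mu]
  · exact (norm_nonneg _).trans (norm_sub_le_mu hx hx)

theorem mu_mono {p : ℕ} [Fact p.Prime] {B C : Finset ℚ_[p]} (h : B ⊆ C) : mu B ≤ mu C := by
  rcases B.eq_empty_or_nonempty with rfl | hB
  · simpa [mu] using mu_nonneg C
  · rw [mu, dif_pos hB]
    refine sup'_le _ _ fun xy hxy => ?_
    rw [mem_product] at hxy
    exact norm_sub_le_mu (h hxy.1) (h hxy.2)

theorem mu_pos {p : ℕ} [Fact p.Prime] {C : Finset ℚ_[p]} {x y : ℚ_[p]}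
    (hx : x ∈ C) (hy : y ∈ C) (hxy : x ≠ y) : 0 < mu C :=
  (norm_pos_iff.2 (sub_ne_zero.2 hxy)).trans_le (norm_sub_le_mu hx hy)

/-- If a finite nonempty set `C ⊆ ℚ_p` is partitioned into pairwise disjoint nonempty
subsets `C_1, …, C_m`, then `Σ_i (#C_i - 1)·μ(C_i) ≤ (#C - 1)·μ(C)`, and the inequality
is strict whenever `m ≥ 2`. -/
theorem sum_energy_parts_le_energy {p : ℕ} [Fact p.Prime]
    (C : Finset ℚ_[p]) (hC : C.Nonempty) (m : ℕ) (D : Fin m → Finset ℚ_[p])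
    (hne : ∀ i, (D i).Nonempty)
    (hdisj : ∀ i j, i ≠ j → Disjoint (D i) (D j))
    (hunion : ∀ x, x ∈ C ↔ ∃ i, x ∈ D i) :
    (∑ i, (((D i).card : ℝ) - 1) * mu (D i)) ≤ ((C.card : ℝ) - 1) * mu C ∧
    (2 ≤ m → (∑ i, (((D i).card : ℝ) - 1) * mu (D i)) < ((C.card : ℝ) - 1) * mu C) := by
  classical
  have hsub : ∀ i, D i ⊆ C := fun i x hx => (hunion x).2 ⟨i, hx⟩
  have hcard : (C.card : ℝ) = ∑ i, ((D i).card : ℝ) := by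
    have hCD : C = univ.biUnion D := by
      ext x
      simp [hunion]
    rw [hCD, card_biUnion fun i _ j _ hij => hdisj i j hij]
    push_cast
    rfl
  have hsum : (∑ i, (((D i).card : ℝ) - 1) * mu (D i)) ≤ ((C.card : ℝ) - m) * mu C := by
    calc (∑ i, (((D i).card : ℝ) - 1) * mu (D i))
        ≤ ∑ i, (((D i).card : ℝ) - 1) * mu C := by
          refine sum_le_sum fun i _ => mul_le_mul_of_nonneg_left (mu_mono (hsub i)) ?_
          have : (1 : ℝ) ≤ (D i).card := by exact_mod_cast (hne i).card_pos
          linarith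
      _ = ((C.card : ℝ) - m) * mu C := by
          rw [← sum_mul, sum_sub_distrib, hcard]
          simp
  refine ⟨hsum.trans (mul_le_mul_of_nonneg_right ?_ (mu_nonneg C)), fun hm =>
    hsum.trans_lt (mul_lt_mul_of_pos_right ?_ ?_)⟩
  · obtain ⟨x, hx⟩ := hC
    obtain ⟨i, -⟩ := (hunion x).1 hx
    have : (1 : ℝ) ≤ m := by exact_mod_cast i.pos
    linarith
  · have : (2 : ℝ) ≤ m := by exact_mod_cast hm
    linarith
  · obtain ⟨x, hx⟩ := hne ⟨0, by lia⟩
    obtain ⟨y, hy⟩ := hne ⟨1, by lia⟩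
    refine mu_pos (hsub _ hx) (hsub _ hy) ?_
    rintro rfl
    exact disjoint_left.1 (hdisj _ _ (by simp)) hx hy
end

section
/- Let p be a prime number, C a finite nonempty subset of ℚ_p, and C′ ⊆ C a cluster of C (for all a ∈ C′ and x ∈ C, |x − a|_p < μ(C′) implies x ∈ C′). Suppose a ∈ C′ is a center of C, i.e. Σ_{x∈C} |x − a|_p ≤ Σ_{x∈C} |x − b|_p for every b ∈ C. Then a is a center of C′, i.e. Σ_{x∈C′} |x − a|_p ≤ Σ_{x∈C′} |x − a′|_p for every a′ ∈ C′. -/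
open Finset

/-- Let `C' ⊆ C` be a cluster of a finite nonempty `C ⊆ ℚ_p`.  If `a ∈ C'` is a center of
`C` (it minimises `b ↦ Σ_{x∈C} ‖x - b‖` over `b ∈ C`), then `a` is a center of `C'`. -/
theorem center_of_cluster {p : ℕ} [Fact p.Prime]
    (C : Finset ℚ_[p]) (hC : C.Nonempty) (C' : Finset ℚ_[p]) (hC'C : C' ⊆ C)
    (hcluster : ∀ a ∈ C', ∀ x ∈ C, ‖x - a‖ < mu C' → x ∈ C')
    (a : ℚ_[p]) (ha : a ∈ C')
    (hcenter : ∀ b ∈ C, ∑ x ∈ C, ‖x - a‖ ≤ ∑ x ∈ C, ‖x - b‖) :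
    ∀ a' ∈ C', ∑ x ∈ C', ‖x - a‖ ≤ ∑ x ∈ C', ‖x - a'‖ := by
  classical
  intro a' ha'
  have houtside : ∑ x ∈ C \ C', ‖x - a'‖ ≤ ∑ x ∈ C \ C', ‖x - a‖ := by
    refine Finset.sum_le_sum fun x hx => ?_
    obtain ⟨hxC, hxC'⟩ := Finset.mem_sdiff.mp hx
    have hmu : mu C' ≤ ‖x - a‖ := not_lt.mp fun h => hxC' (hcluster a ha x hxC h)
    calc ‖x - a'‖ = ‖(x - a) + (a - a')‖ := by rw [sub_add_sub_cancel]
      _ ≤ max ‖x - a‖ ‖a - a'‖ := IsUltrametricDist.norm_add_le_max _ _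
      _ ≤ ‖x - a‖ := max_le le_rfl ((norm_sub_le_mu ha ha').trans hmu)
  have hle := hcenter a' (hC'C ha')
  rw [← Finset.sum_sdiff hC'C, ← Finset.sum_sdiff hC'C] at hle
  linarith
end

section
/- Let P_1, …, P_n be finitely many polynomials with real coefficients. Then there exists a finite set S of prime numbers such that for all primes p, q ∉ S and all indices i, j ∈ {1, …, n}: P_i(1/p) ≤ P_j(1/p) if and only if P_i(1/q) ≤ P_j(1/q). In other words, the ranking of the values P_1(1/p), …, P_n(1/p) is the same for all but finitely many primes p. -/
open Filter Topology in
/-- A real polynomial has constant sign on some punctured right neighbourhood of `0`. -/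
theorem Polynomial.eventually_nonneg_or_eventually_neg_nhdsGT_zero (Q : Polynomial ℝ) :
    (∀ᶠ x in 𝓝[>] (0 : ℝ), 0 ≤ Q.eval x) ∨ ∀ᶠ x in 𝓝[>] (0 : ℝ), Q.eval x < 0 := by
  rcases eq_or_ne Q 0 with rfl | hQ
  · simp
  obtain ⟨R, hR, hdvd⟩ := Polynomial.exists_eq_pow_rootMultiplicity_mul_and_not_dvd Q hQ 0
  have hR0 : R.eval 0 ≠ 0 := fun h => hdvd (Polynomial.dvd_iff_isRoot.2 h)
  have heval (x : ℝ) : Q.eval x = x ^ Q.rootMultiplicity 0 * R.eval x := by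
    conv_lhs => rw [hR]
    simp
  have hcont : Tendsto (fun x => R.eval x) (𝓝[>] 0) (𝓝 (R.eval 0)) :=
    R.continuous.continuousAt.mono_left nhdsWithin_le_nhds
  rcases hR0.lt_or_gt with h | h
  · right
    filter_upwards [hcont.eventually_lt_const h, self_mem_nhdsWithin] with x hx hpos
    rw [heval]
    exact mul_neg_of_pos_of_neg (pow_pos hpos _) hx
  · left
    filter_upwards [hcont.eventually_const_lt h, self_mem_nhdsWithin] with x hx hpos
    rw [heval]
    exact (mul_pos (pow_pos hpos _) hx).le

open Filter Topology in
/-- The comparison of two real polynomials at `1 / m` does not depend on `m` for large `m`. -/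
theorem Polynomial.exists_eventually_eval_one_div_le_iff (A B : Polynomial ℝ) :
    ∃ c : Prop, ∀ᶠ m : ℕ in atTop, (A.eval (1 / (m : ℝ)) ≤ B.eval (1 / (m : ℝ)) ↔ c) := by
  have hlim : Tendsto (fun m : ℕ => 1 / (m : ℝ)) atTop (𝓝[>] 0) := by
    simpa only [one_div, Function.comp_def] using
      tendsto_inv_atTop_nhdsGT_zero.comp (tendsto_natCast_atTop_atTop (R := ℝ))
  rcases (B - A).eventually_nonneg_or_eventually_neg_nhdsGT_zero with h | h
  · refine ⟨True, (hlim.eventually h).mono fun m hm => ?_⟩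
    simpa using hm
  · refine ⟨False, (hlim.eventually h).mono fun m hm => ?_⟩
    simpa using hm


/-- Given finitely many real polynomials `P_1, …, P_n`, there is a finite set `S` of
primes such that for all primes `p, q ∉ S` and all indices `i, j`, one has
`P_i(1/p) ≤ P_j(1/p)` if and only if `P_i(1/q) ≤ P_j(1/q)`: the ranking of the values
`P_1(1/p), …, P_n(1/p)` is the same for all but finitely many primes `p`. -/
theorem ranking_independent_of_prime (n : ℕ) (P : Fin n → Polynomial ℝ) :
    ∃ S : Finset ℕ, ∀ p q : ℕ, p.Prime → q.Prime → p ∉ S → q ∉ S →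
      ∀ i j : Fin n,
        ((P i).eval (1 / (p : ℝ)) ≤ (P j).eval (1 / (p : ℝ)) ↔
          (P i).eval (1 / (q : ℝ)) ≤ (P j).eval (1 / (q : ℝ))) := by
  choose c hc using fun i j => (P i).exists_eventually_eval_one_div_le_iff (P j)
  obtain ⟨N, hN⟩ := Filter.eventually_atTop.1
    (Filter.eventually_all.2 fun i => Filter.eventually_all.2 (hc i))
  refine ⟨Finset.range N, fun p q _ _ hp hq i j => ?_⟩
  rw [Finset.mem_range, not_lt] at hp hq
  exact (hN p hp i j).trans (hN q hq i j).symm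
end
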